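/- arXiv:2111.14432 — 5 statements merged into one kernel-verified Lean document; each statement's English description precedes it below -/
import Mathlib

section
/- Let α, β ∈ IF_n. Then: (1) α 𝓡 β (i.e. there exist u, v ∈ IF_n with αu = β and βv = α) if and only if dom α = dom β; (2) α 𝓛 β (i.e. there exist u, v ∈ IF_n with uα = β and vβ = α) if and only if im α = im β; (3) α 𝓗 β (i.e. both α 𝓛 β and α 𝓡 β hold) if and only if dom α = dom β and im α = im β. -/
/-!
Common framework: partial injections on `X_n = {1, …, n}`, the fence order,
fence-preserving partial injections, the semigroups `PFI_n`, `IF_n`,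
the set `J` of elements of rank at least `n - 2`, and (for even `n`)
the generating system `G`.
-/

namespace FencePaper

/-- The fence (zigzag) order on `{1, …, n}`: `a <_f b` iff `|a - b| = 1` and `b` is even. -/
def fenceLt (a b : ℕ) : Prop := (a + 1 = b ∨ b + 1 = a) ∧ Even b

/-- A partial injection of `X_n = {1, …, n}`, given by its graph. -/
structure PartialInj (n : ℕ) where
  graph : Set (ℕ × ℕ)
  mem_le : ∀ p ∈ graph, 1 ≤ p.1 ∧ p.1 ≤ n ∧ 1 ≤ p.2 ∧ p.2 ≤ n
  functional : ∀ p ∈ graph, ∀ q ∈ graph, p.1 = q.1 → p.2 = q.2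
  injOn : ∀ p ∈ graph, ∀ q ∈ graph, p.2 = q.2 → p.1 = q.1

namespace PartialInj

variable {n : ℕ}

theorem ext' {α β : PartialInj n} (h : α.graph = β.graph) : α = β := by
  cases α
  cases β
  simp only at h
  subst h
  rfl

/-- The domain of a partial injection. -/
def dom (α : PartialInj n) : Set ℕ := {x | ∃ y, (x, y) ∈ α.graph}

/-- The image (range) of a partial injection. -/
def im (α : PartialInj n) : Set ℕ := {y | ∃ x, (x, y) ∈ α.graph}

/-- The rank of a partial injection: the cardinality of its image. -/
noncomputable def rank (α : PartialInj n) : ℕ := α.im.ncard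

/-- The inverse partial injection. -/
def inv (α : PartialInj n) : PartialInj n where
  graph := {p | (p.2, p.1) ∈ α.graph}
  mem_le := by
    rintro p hp
    obtain ⟨h1, h2, h3, h4⟩ := α.mem_le _ hp
    exact ⟨h3, h4, h1, h2⟩
  functional := by
    rintro p hp q hq h
    exact α.injOn _ hp _ hq h
  injOn := by
    rintro p hp q hq h
    exact α.functional _ hp _ hq h

/-- Composition: first `α`, then `β` (maps act on the right). -/
def comp (α β : PartialInj n) : PartialInj n where
  graph := {p | ∃ y, (p.1, y) ∈ α.graph ∧ (y, p.2) ∈ β.graph}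
  mem_le := by
    rintro p ⟨y, h1, h2⟩
    obtain ⟨a, b, -, -⟩ := α.mem_le _ h1
    obtain ⟨-, -, c, d⟩ := β.mem_le _ h2
    exact ⟨a, b, c, d⟩
  functional := by
    rintro p ⟨y, h1, h2⟩ q ⟨z, h3, h4⟩ h
    have hyz : y = z := α.functional _ h1 _ h3 h
    subst hyz
    exact β.functional (y, p.2) h2 (y, q.2) h4 rfl
  injOn := by
    rintro p ⟨y, h1, h2⟩ q ⟨z, h3, h4⟩ h
    have hyz : y = z := β.injOn _ h2 _ h4 h
    subst hyz
    exact α.injOn (p.1, y) h1 (q.1, y) h3 rfl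

/-- The partial identity map on `D ∩ {1, …, n}`. -/
def pid (n : ℕ) (D : Set ℕ) : PartialInj n where
  graph := {p | p.1 ∈ Set.Icc 1 n ∧ p.1 ∈ D ∧ p.2 = p.1}
  mem_le := by
    rintro p ⟨⟨h1, h2⟩, -, h3⟩
    refine ⟨h1, h2, ?_, ?_⟩ <;> omega
  functional := by
    rintro p ⟨-, -, h1⟩ q ⟨-, -, h2⟩ h
    rw [h1, h2, h]
  injOn := by
    rintro p ⟨-, -, h1⟩ q ⟨-, -, h2⟩ h
    rw [← h1, ← h2, h]

instance : Monoid (PartialInj n) where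
  mul := comp
  one := pid n (Set.Icc 1 n)
  mul_assoc a b c := by
    apply ext'
    ext q
    constructor
    · rintro ⟨y, ⟨z, h1, h2⟩, h3⟩
      exact ⟨z, h1, y, h2, h3⟩
    · rintro ⟨z, h1, y, h2, h3⟩
      exact ⟨y, ⟨z, h1, h2⟩, h3⟩
  one_mul a := by
    apply ext'
    ext q
    constructor
    · rintro ⟨y, ⟨-, -, h⟩, h2⟩
      have hy : y = q.1 := h
      rw [hy] at h2
      exact h2
    · intro hq
      obtain ⟨h1, h2, -, -⟩ := a.mem_le _ hq
      exact ⟨q.1, ⟨⟨h1, h2⟩, ⟨h1, h2⟩, rfl⟩, hq⟩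
  mul_one a := by
    apply ext'
    ext q
    constructor
    · rintro ⟨y, h1, ⟨-, -, h⟩⟩
      have hy : q.2 = y := h
      rw [← hy] at h1
      exact h1
    · intro hq
      obtain ⟨-, -, h3, h4⟩ := a.mem_le _ hq
      exact ⟨q.2, hq, ⟨h3, h4⟩, ⟨h3, h4⟩, rfl⟩

theorem mul_graph (α β : PartialInj n) :
    (α * β).graph = {p | ∃ y, (p.1, y) ∈ α.graph ∧ (y, p.2) ∈ β.graph} := rfl

/-- `α` is fence-preserving. -/
def FP (α : PartialInj n) : Prop :=
  ∀ p ∈ α.graph, ∀ q ∈ α.graph, fenceLt p.1 q.1 → fenceLt p.2 q.2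

/-- The image of a subset under a partial injection. -/
def imageOf (α : PartialInj n) (S : Set ℕ) : Set ℕ := {y | ∃ x ∈ S, (x, y) ∈ α.graph}

end PartialInj

open PartialInj

/-- `PFI_n`: the semigroup of all fence-preserving partial injections. -/
def PFIset (n : ℕ) : Set (PartialInj n) := {α | α.FP}

/-- `IF_n = {α ∈ PFI_n : α⁻¹ ∈ PFI_n}`. -/
def IFset (n : ℕ) : Set (PartialInj n) := {α | α.FP ∧ α.inv.FP}

/-- `J = {α ∈ IF_n : rank α ≥ n - 2}`. -/
def Jset (n : ℕ) : Set (PartialInj n) := {α | α ∈ IFset n ∧ n - 2 ≤ α.rank}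

/-- `A` is a maximal block of consecutive integers of `D ⊆ {1, …, n}`. -/
def IsBlock (n : ℕ) (D A : Set ℕ) : Prop :=
  ∃ i r : ℕ, 1 ≤ i ∧ A = Set.Icc i (i + r) ∧ A ⊆ D ∧
    (i = 1 ∨ i - 1 ∉ D) ∧ (i + r = n ∨ i + r + 1 ∉ D)

/-- `α(k)`: the maximal blocks of `dom α` of cardinality `k`. -/
def blockSet {n : ℕ} (α : PartialInj n) (k : ℕ) : Set (Set ℕ) :=
  {A | IsBlock n α.dom A ∧ A.ncard = k}

/-- `α°(2k+1)`: the maximal blocks `{i, …, i+2k}` of `dom α` with `i` odd. -/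
def oddBlockSet {n : ℕ} (α : PartialInj n) (k : ℕ) : Set (Set ℕ) :=
  {A | A ∈ blockSet α (2 * k + 1) ∧ Odd (sInf A)}

/-- The graph of `σ₁`: domain `X_n ∖ {2}`, `1 ↦ n`, `x ↦ x - 2` for `3 ≤ x ≤ n`. -/
def sigma1Graph (n : ℕ) : Set (ℕ × ℕ) :=
  {q | 1 ≤ q.1 ∧ q.1 ≤ n ∧ q.1 ≠ 2 ∧ q.2 = if q.1 = 1 then n else q.1 - 2}

/-- The graph of `σ₂ = σ₁⁻¹`: domain `X_n ∖ {n-1}`, `x ↦ x + 2` for `x ≤ n - 2`, `n ↦ 1`. -/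
def sigma2Graph (n : ℕ) : Set (ℕ × ℕ) :=
  {q | 1 ≤ q.1 ∧ q.1 ≤ n ∧ q.1 ≠ n - 1 ∧ q.2 = if q.1 = n then 1 else q.1 + 2}

/-- The graph of `γ_i`: domain `X_n ∖ {i}`, `x ↦ i - x` for `x < i`, `x ↦ x` for `x > i`. -/
def gammaGraph (n i : ℕ) : Set (ℕ × ℕ) :=
  {q | 1 ≤ q.1 ∧ q.1 ≤ n ∧ q.1 ≠ i ∧ q.2 = if q.1 < i then i - q.1 else q.1}

/-- The graph of `δ_i`: domain `X_n ∖ {i}`, `x ↦ x` for `x < i`, `x ↦ n + i + 1 - x` for `x > i`. -/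
def deltaGraph (n i : ℕ) : Set (ℕ × ℕ) :=
  {q | 1 ≤ q.1 ∧ q.1 ≤ n ∧ q.1 ≠ i ∧ q.2 = if q.1 < i then q.1 else n + i + 1 - q.1}

/-- The graph of `β_{i,j}`: domain `X_n ∖ {i, j}`, reversing the interval strictly
between `i` and `j` and fixing everything else. -/
def betaGraph (n i j : ℕ) : Set (ℕ × ℕ) :=
  {q | 1 ≤ q.1 ∧ q.1 ≤ n ∧ q.1 ≠ i ∧ q.1 ≠ j ∧
    q.2 = if i < q.1 ∧ q.1 < j then i + j - q.1 else q.1}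

/-- The generating system `G` (for even `n`), given elements `σ₁, σ₂` and families
`γ, δ` realizing the prescribed graphs. -/
def Gset (n : ℕ) (σ₁ σ₂ : PartialInj n) (γ δ : ℕ → PartialInj n) : Set (PartialInj n) :=
  {pid n (Set.Icc 1 n), σ₁, σ₂} ∪
    {g | ∃ i, Even i ∧ 4 ≤ i ∧ i ≤ n ∧ g = γ i} ∪
    {g | ∃ i, Odd i ∧ i ≤ n - 3 ∧ g = δ i}

namespace PartialInj

variable {n : ℕ}

theorem dom_mul_subset (α β : PartialInj n) : (α * β).dom ⊆ α.dom := by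
  rintro x ⟨_, y, hxy, -⟩
  exact ⟨y, hxy⟩

theorem im_mul_subset (α β : PartialInj n) : (α * β).im ⊆ β.im := by
  rintro z ⟨_, y, -, hyz⟩
  exact ⟨y, hyz⟩

theorem mul_inv_mul_of_dom_subset {α β : PartialInj n} (h : β.dom ⊆ α.dom) :
    α * (α.inv * β) = β := by
  apply ext'
  ext ⟨x, y⟩
  constructor
  · rintro ⟨z, hxz, w, hwz, hwy⟩
    obtain rfl : x = w := α.injOn _ hxz _ hwz rfl
    exact hwy
  · intro hxy
    obtain ⟨z, hxz⟩ := h ⟨y, hxy⟩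
    exact ⟨z, hxz, x, hxz, hxy⟩

theorem mul_inv_mul_of_im_subset {α β : PartialInj n} (h : β.im ⊆ α.im) :
    β * α.inv * α = β := by
  apply ext'
  ext ⟨x, y⟩
  constructor
  · rintro ⟨z, ⟨w, hxw, hzw⟩, hzy⟩
    obtain rfl : w = y := α.functional _ hzw _ hzy rfl
    exact hxw
  · intro hxy
    obtain ⟨z, hzy⟩ := h ⟨x, hxy⟩
    exact ⟨z, ⟨y, hxy, hzy⟩, hzy⟩

theorem FP.mul {α β : PartialInj n} (hα : α.FP) (hβ : β.FP) : (α * β).FP := by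
  rintro p ⟨y, hpy, hyp⟩ q ⟨z, hqz, hzq⟩ h
  exact hβ (y, p.2) hyp (z, q.2) hzq (hα (p.1, y) hpy (q.1, z) hqz h)

theorem inv_mul (α β : PartialInj n) : (α * β).inv = β.inv * α.inv := by
  apply ext'
  ext p
  constructor <;> rintro ⟨y, h₁, h₂⟩ <;> exact ⟨y, h₂, h₁⟩

end PartialInj

theorem inv_mem_IFset {n : ℕ} {α : PartialInj n} (hα : α ∈ IFset n) : α.inv ∈ IFset n :=
  ⟨hα.2, hα.1⟩

theorem mul_mem_IFset {n : ℕ} {α β : PartialInj n} (hα : α ∈ IFset n) (hβ : β ∈ IFset n) :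
    α * β ∈ IFset n :=
  ⟨hα.1.mul hβ.1, by rw [inv_mul]; exact hβ.2.mul hα.2⟩

theorem exists_mul_right_eq_iff {n : ℕ} {α β : PartialInj n}
    (hα : α ∈ IFset n) (hβ : β ∈ IFset n) :
    (∃ u ∈ IFset n, α * u = β) ↔ β.dom ⊆ α.dom := by
  constructor
  · rintro ⟨u, -, rfl⟩
    exact dom_mul_subset α u
  · intro h
    exact ⟨_, mul_mem_IFset (inv_mem_IFset hα) hβ, mul_inv_mul_of_dom_subset h⟩

theorem exists_mul_left_eq_iff {n : ℕ} {α β : PartialInj n}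
    (hα : α ∈ IFset n) (hβ : β ∈ IFset n) :
    (∃ u ∈ IFset n, u * α = β) ↔ β.im ⊆ α.im := by
  constructor
  · rintro ⟨u, -, rfl⟩
    exact im_mul_subset u α
  · intro h
    exact ⟨_, mul_mem_IFset hβ (inv_mem_IFset hα), mul_inv_mul_of_im_subset h⟩

/-- Green's relations `𝓡`, `𝓛`, `𝓗` on `IF_n`. -/
theorem green_R_L_H (n : ℕ) (α β : PartialInj n)
    (hα : α ∈ IFset n) (hβ : β ∈ IFset n) :
    (((∃ u ∈ IFset n, α * u = β) ∧ (∃ v ∈ IFset n, β * v = α)) ↔ α.dom = β.dom) ∧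
    (((∃ u ∈ IFset n, u * α = β) ∧ (∃ v ∈ IFset n, v * β = α)) ↔ α.im = β.im) ∧
    ((((∃ u ∈ IFset n, u * α = β) ∧ (∃ v ∈ IFset n, v * β = α)) ∧
        ((∃ u ∈ IFset n, α * u = β) ∧ (∃ v ∈ IFset n, β * v = α))) ↔
      (α.dom = β.dom ∧ α.im = β.im)) := by
  rw [exists_mul_right_eq_iff hα hβ, exists_mul_right_eq_iff hβ hα,
    exists_mul_left_eq_iff hα hβ, exists_mul_left_eq_iff hβ hα]
  simp only [Set.Subset.antisymm_iff]
  tauto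

end FencePaper
end

section
/- Let m, p be positive integers with m + p ≤ n and m ≡ m + p (mod 2). Let α be the partial injection of X_n with dom α = X_n ∖ {m − 1, m + p + 1}, xα = x for x ∈ dom α with x ≤ m − 2 or x ≥ m + p + 2, and xα = 2m + p − x for m ≤ x ≤ m + p. Then α ∈ IF_n, rank α ≥ n − 2 (so α ∈ J), and α⁻¹ = α (so also α⁻¹ ∈ J). -/
/-!
Common framework: partial injections on `X_n = {1, …, n}`, the fence order,
fence-preserving partial injections, the semigroups `PFI_n`, `IF_n`,
the set `J` of elements of rank at least `n - 2`, and (for even `n`)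
the generating system `G`.
-/

namespace FencePaper

open PartialInj

/-- Lemma 6: the interval-reversing map on `{m, …, m+p}` (with `m ≡ m+p (mod 2)`)
belongs to `J` and is self-inverse. -/
theorem lemma6 (n m p : ℕ) (hm : 1 ≤ m) (hp : 1 ≤ p) (hmp : m + p ≤ n)
    (hpar : m % 2 = (m + p) % 2) (α : PartialInj n)
    (hgraph : α.graph = {q : ℕ × ℕ | 1 ≤ q.1 ∧ q.1 ≤ n ∧ q.1 ≠ m - 1 ∧ q.1 ≠ m + p + 1 ∧
      q.2 = if m ≤ q.1 ∧ q.1 ≤ m + p then 2 * m + p - q.1 else q.1}) :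
    α ∈ IFset n ∧ n - 2 ≤ α.rank ∧ α ∈ Jset n ∧ α.inv = α ∧ α.inv ∈ Jset n := by
  have hself : α.inv = α := by
    apply ext'
    ext ⟨x, y⟩
    change (y, x) ∈ α.graph ↔ (x, y) ∈ α.graph
    simp only [hgraph, Set.mem_ofPred_eq]
    constructor <;> rintro ⟨h1, h2, h3, h4, h5⟩ <;> split_ifs at h5 ⊢ <;> omega
  have hFP : α.FP := by
    rintro ⟨x, x'⟩ hx ⟨y, y'⟩ hy ⟨hadj, heven⟩
    simp only [hgraph, Set.mem_ofPred_eq] at hx hy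
    obtain ⟨hx1, hx2, hx3, hx4, hx5⟩ := hx
    obtain ⟨hy1, hy2, hy3, hy4, hy5⟩ := hy
    simp only [Nat.even_iff] at hadj heven
    simp only [fenceLt, Nat.even_iff]
    split_ifs at hx5 hy5 <;> omega
  have hIF : α ∈ IFset n := ⟨hFP, hself.symm ▸ hFP⟩
  have hrank : n - 2 ≤ α.rank := by
    have hsub : ((Finset.Icc 1 n \ {m - 1, m + p + 1} : Finset ℕ) : Set ℕ) ⊆ α.im := by
      intro x hx
      simp only [Finset.coe_sdiff, Finset.coe_Icc, Finset.coe_insert, Finset.coe_singleton,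
        Set.mem_sdiff, Set.mem_Icc, Set.mem_insert_iff, Set.mem_singleton_iff, not_or] at hx
      obtain ⟨⟨h1, h2⟩, h3, h4⟩ := hx
      rw [← hself]
      refine ⟨if m ≤ x ∧ x ≤ m + p then 2 * m + p - x else x, ?_⟩
      change (x, _) ∈ α.graph
      rw [hgraph]
      exact ⟨h1, h2, h3, h4, rfl⟩
    have hfin : α.im.Finite := (Set.finite_Icc 1 n).subset <| by
      rintro y ⟨x, hxy⟩
      exact (α.mem_le _ hxy).2.2
    have hle := Set.ncard_le_ncard hsub hfin
    rw [Set.ncard_coe_finset] at hle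
    have hdiff := Finset.le_card_sdiff ({m - 1, m + p + 1} : Finset ℕ) (Finset.Icc 1 n)
    have htwo : ({m - 1, m + p + 1} : Finset ℕ).card ≤ 2 := Finset.card_le_two
    rw [Nat.card_Icc] at hdiff
    change n - 2 ≤ α.im.ncard
    omega
  have hJ : α ∈ Jset n := ⟨hIF, hrank⟩
  exact ⟨hIF, hrank, hJ, hself, hself.symm ▸ hJ⟩

end FencePaper
end

section
/- Let m, p, k be positive integers with m + p + 2k ≤ n. Let α be the partial injection of X_n with dom α = {1, …, m − 2} ∪ {m, …, m + p} ∪ {m + p + 2k + 2, …, n}, where xα = x for x ≤ m − 2 and for x ≥ m + p + 2k + 2, and xα = x + 2k for m ≤ x ≤ m + p. Then α ∈ ⟨J⟩ and α⁻¹ ∈ ⟨J⟩. -/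
/-!
Common framework: partial injections on `X_n = {1, …, n}`, the fence order,
fence-preserving partial injections, the semigroups `PFI_n`, `IF_n`,
the set `J` of elements of rank at least `n - 2`, and (for even `n`)
the generating system `G`.
-/

namespace FencePaper

open PartialInj

namespace PartialInj

variable {n : ℕ}

theorem inv_pid (D : Set ℕ) : (pid n D).inv = pid n D := by
  apply ext'
  ext ⟨x, y⟩
  constructor
  · rintro ⟨h1, h2, rfl : x = y⟩
    exact ⟨h1, h2, rfl⟩
  · rintro ⟨h1, h2, rfl : y = x⟩
    exact ⟨h1, h2, rfl⟩

theorem pid_mul_pid (D E : Set ℕ) : pid n D * pid n E = pid n (D ∩ E) := by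
  apply ext'
  ext ⟨x, y⟩
  constructor
  · rintro ⟨z, ⟨h1, h2, rfl : z = x⟩, ⟨-, h3, h4⟩⟩
    exact ⟨h1, ⟨h2, h3⟩, h4⟩
  · rintro ⟨h1, ⟨h2, h3⟩, h4⟩
    exact ⟨x, ⟨h1, h2, rfl⟩, ⟨h1, h3, h4⟩⟩

theorem pid_inter_Icc (D : Set ℕ) : pid n (Set.Icc 1 n ∩ D) = pid n D := by
  apply ext'
  ext q
  exact ⟨fun ⟨h1, h2, h3⟩ => ⟨h1, h2.2, h3⟩, fun ⟨h1, h2, h3⟩ => ⟨h1, ⟨h1, h2⟩, h3⟩⟩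

/-- A partial injection whose image misses at most two points has rank at least `n - 2`. -/
theorem le_rank_of_diff_pair_subset {α : PartialInj n} (a b : ℕ)
    (h : Set.Icc 1 n \ {a, b} ⊆ α.im) : n - 2 ≤ α.rank := by
  have hfin : α.im.Finite := (Set.finite_Icc 1 n).subset fun y ⟨x, hx⟩ =>
    ⟨(α.mem_le _ hx).2.2.1, (α.mem_le _ hx).2.2.2⟩
  have h1 := Set.ncard_le_ncard h hfin
  have h2 := Set.le_ncard_sdiff ({a, b} : Set ℕ) (Set.Icc 1 n)
  have h3 := Set.ncard_insert_le a {b}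
  rw [Set.ncard_singleton] at h3
  have h4 : (Set.Icc 1 n).ncard = n := by simp [Set.ncard_eq_toFinset_card']
  unfold rank
  omega

theorem pid_mem_IFset (D : Set ℕ) : pid n D ∈ IFset n := by
  have h : (pid n D).FP := by
    rintro ⟨x, x'⟩ ⟨-, -, rfl : x' = x⟩ ⟨y, y'⟩ ⟨-, -, rfl : y' = y⟩ hxy
    exact hxy
  exact ⟨h, (inv_pid D).symm ▸ h⟩

theorem pid_compl_singleton_mem_Jset (a : ℕ) : pid n {a}ᶜ ∈ Jset n :=
  ⟨pid_mem_IFset _, le_rank_of_diff_pair_subset a a fun x hx =>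
    ⟨x, hx.1, fun h => hx.2 (Or.inl h), rfl⟩⟩

theorem pid_mem_closure_Jset (D : Set ℕ) : pid n D ∈ Subsemigroup.closure (Jset n) := by
  have key : ∀ S : Finset ℕ, pid n (S : Set ℕ)ᶜ ∈ Subsemigroup.closure (Jset n) := by
    intro S
    induction S using Finset.induction_on with
    | empty =>
      exact Subsemigroup.subset_closure ⟨pid_mem_IFset _,
        le_rank_of_diff_pair_subset 0 0 fun x hx => ⟨x, hx.1, by simp, rfl⟩⟩
    | insert a S _ ih =>
      rw [Finset.coe_insert, Set.insert_eq, Set.compl_union, ← pid_mul_pid]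
      exact mul_mem (Subsemigroup.subset_closure (pid_compl_singleton_mem_Jset a)) ih
  classical
  have h := key ((Finset.Icc 1 n).filter (· ∉ D))
  rw [← pid_inter_Icc] at h ⊢
  convert h using 2
  ext x
  simp only [Set.mem_inter_iff, Set.mem_Icc, Set.mem_compl_iff, Finset.mem_coe,
    Finset.mem_filter, Finset.mem_Icc]
  tauto

/-- The partial injection `β_{i,j}`, where `i = 0` and `j = n + 1` are allowed. -/
def beta (n i j : ℕ) (hj : j ≤ n + 1) : PartialInj n where
  graph := betaGraph n i j
  mem_le := by
    rintro ⟨x, y⟩ ⟨h1, h2, h3, h4, h5⟩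
    dsimp only at *
    split_ifs at h5 <;> omega
  functional := by
    rintro ⟨x, y⟩ ⟨-, -, -, -, h⟩ ⟨x', y'⟩ ⟨-, -, -, -, h'⟩ (rfl : x = x')
    exact h.trans h'.symm
  injOn := by
    rintro ⟨x, y⟩ ⟨-, -, -, -, h⟩ ⟨x', y'⟩ ⟨-, -, -, -, h'⟩ (rfl : y = y')
    dsimp only at *
    split_ifs at h h' <;> omega

theorem inv_beta (i j : ℕ) (hj : j ≤ n + 1) : (beta n i j hj).inv = beta n i j hj := by
  apply ext'
  ext ⟨x, y⟩
  simp only [inv, beta, betaGraph, Set.mem_ofPred_eq]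
  constructor <;> rintro ⟨h1, h2, h3, h4, h5⟩ <;> split_ifs at h5 ⊢ <;> omega

theorem beta_mem_Jset (i j : ℕ) (hj : j ≤ n + 1) (hij : Even (i + j)) :
    beta n i j hj ∈ Jset n := by
  have h : (beta n i j hj).FP := by
    rintro ⟨x, y⟩ ⟨h1, h2, h3, h4, h5⟩ ⟨x', y'⟩ ⟨h1', h2', h3', h4', h5'⟩ ⟨h6, h7⟩
    dsimp only at *
    rw [Nat.even_iff] at hij h7
    unfold fenceLt
    rw [Nat.even_iff]
    split_ifs at h5 h5' <;> omega
  refine ⟨⟨h, (inv_beta i j hj).symm ▸ h⟩, le_rank_of_diff_pair_subset i j ?_⟩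
  rintro x ⟨⟨h1, h2⟩, h3⟩
  simp only [Set.mem_insert_iff, Set.mem_singleton_iff, not_or] at h3
  obtain ⟨h3, h4⟩ := h3
  rw [im, ← inv_beta]
  exact ⟨if i < x ∧ x < j then i + j - x else x, h1, h2, h3, h4, rfl⟩

end PartialInj

/-- Corollary 2: the shift by `2k` of the interval `{m, …, m+p}` lies in `⟨J⟩`. -/
theorem cor2 (n m p k : ℕ) (hm : 1 ≤ m) (hp : 1 ≤ p) (hk : 1 ≤ k)
    (hmp : m + p + 2 * k ≤ n) (α : PartialInj n)
    (hgraph : α.graph = {q : ℕ × ℕ |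
      q.1 ∈ Set.Icc 1 (m - 2) ∪ Set.Icc m (m + p) ∪ Set.Icc (m + p + 2 * k + 2) n ∧
      q.2 = if m ≤ q.1 ∧ q.1 ≤ m + p then q.1 + 2 * k else q.1}) :
    α ∈ Subsemigroup.closure (Jset n) ∧ α.inv ∈ Subsemigroup.closure (Jset n) := by
  obtain ⟨e, he, hpe⟩ : ∃ e, e ≤ 1 ∧ Even (p + e) := by
    rcases Nat.even_or_odd p with h | h
    · exact ⟨0, by omega, h⟩
    · exact ⟨1, le_rfl, h.add_one⟩
  have hj₁ : m + p + 1 + e ≤ n + 1 := by omega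
  have hj₂ : m + p + 2 * k + 1 ≤ n + 1 := by omega
  have hJ₁ := beta_mem_Jset (m - 1) (m + p + 1 + e) hj₁ (by
    rw [Nat.even_iff] at *
    omega)
  have hJ₂ := beta_mem_Jset (m - 1 + e) (m + p + 2 * k + 1) hj₂ (by
    rw [Nat.even_iff] at *
    omega)
  set D : Set ℕ := Set.Icc 1 (m - 2) ∪ Set.Icc m (m + p) ∪ Set.Icc (m + p + 2 * k + 2) n with hD
  have hα : α = pid n D * (beta n (m - 1) _ hj₁ * beta n (m - 1 + e) _ hj₂) := by
    apply ext'
    rw [hgraph]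
    ext ⟨x, y⟩
    simp only [mul_graph, pid, beta, betaGraph, hD, Set.mem_ofPred_eq, Set.mem_union, Set.mem_Icc]
    constructor
    · rintro ⟨h1, h2⟩
      refine ⟨x, ⟨by omega, h1, rfl⟩, _, ⟨by omega, by omega, by omega, by omega, rfl⟩, ?_⟩
      split_ifs at h2 ⊢ <;> omega
    · rintro ⟨_, ⟨h1, h2, rfl⟩, z, ⟨-, -, h3, h4, h5⟩, -, -, h6, h7, h8⟩
      refine ⟨h2, ?_⟩
      split_ifs at h5 h8 ⊢ <;> omega
  have hD_mem := pid_mem_closure_Jset (n := n) D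
  have h₁ := Subsemigroup.subset_closure hJ₁
  have h₂ := Subsemigroup.subset_closure hJ₂
  rw [hα]
  refine ⟨mul_mem hD_mem (mul_mem h₁ h₂), ?_⟩
  rw [inv_mul, inv_mul, inv_pid, inv_beta, inv_beta]
  exact mul_mem (mul_mem h₂ h₁) hD_mem

end FencePaper
end

section
/- Let m, p, k be positive integers with p even and m + p + 2k ≤ n. Let α be the partial injection of X_n with dom α = {1, …, m − 2} ∪ {m, …, m + p} ∪ {m + p + 2k + 2, …, n}, where xα = x for x ≤ m − 2 and for x ≥ m + p + 2k + 2, and xα = 2m + p + 2k − x for m ≤ x ≤ m + p (so mα = m + p + 2k and (m + p)α = m + 2k). Then α ∈ ⟨J⟩ and α⁻¹ ∈ ⟨J⟩. -/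
/-!
Common framework: partial injections on `X_n = {1, …, n}`, the fence order,
fence-preserving partial injections, the semigroups `PFI_n`, `IF_n`,
the set `J` of elements of rank at least `n - 2`, and (for even `n`)
the generating system `G`.
-/

namespace FencePaper

open PartialInj

theorem mem_Jset_of_diff_pair_subset_im {n : ℕ} {α : PartialInj n} (hα : α ∈ IFset n) (a b : ℕ)
    (h : Set.Icc 1 n \ {a, b} ⊆ α.im) : α ∈ Jset n := by
  refine ⟨hα, ?_⟩
  have hfin : α.im.Finite := (Set.finite_Icc 1 n).subset fun y ⟨x, hx⟩ =>
    ⟨(α.mem_le _ hx).2.2.1, (α.mem_le _ hx).2.2.2⟩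
  have hcard : (Set.Icc 1 n).ncard - ({a, b} : Set ℕ).ncard ≤ (Set.Icc 1 n \ {a, b}).ncard :=
    Set.le_ncard_sdiff _ _ (Set.toFinite _)
  have hIcc : (Set.Icc 1 n).ncard = n := by
    rw [← Finset.coe_Icc, Set.ncard_coe_finset, Nat.card_Icc, Nat.add_sub_cancel]
  have hpair : ({a, b} : Set ℕ).ncard ≤ 2 :=
    (Set.ncard_insert_le a {b}).trans (by rw [Set.ncard_singleton])
  have hle : (Set.Icc 1 n \ {a, b}).ncard ≤ α.rank := Set.ncard_le_ncard h hfin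
  omega

theorem pid_mem_IFset (n : ℕ) (D : Set ℕ) : pid n D ∈ IFset n := by
  constructor <;> rintro ⟨x, y⟩ ⟨-, -, hp⟩ ⟨z, w⟩ ⟨-, -, hq⟩ h <;> simp_all

theorem pid_compl_mem_closure (n : ℕ) (S : Finset ℕ) :
    pid n (S : Set ℕ)ᶜ ∈ Subsemigroup.closure (Jset n) := by
  induction S using Finset.induction_on with
  | empty =>
    refine Subsemigroup.subset_closure (mem_Jset_of_diff_pair_subset_im (pid_mem_IFset _ _) 0 0 ?_)
    rintro x ⟨hx, -⟩
    exact ⟨x, hx, by simp, rfl⟩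
  | insert a S _ ih =>
    have ha : pid n {a}ᶜ ∈ Subsemigroup.closure (Jset n) := by
      refine Subsemigroup.subset_closure
        (mem_Jset_of_diff_pair_subset_im (pid_mem_IFset _ _) a a ?_)
      rintro x ⟨hx, hxa⟩
      exact ⟨x, hx, by simpa using hxa, rfl⟩
    have hmul : pid n ((insert a S : Finset ℕ) : Set ℕ)ᶜ = pid n {a}ᶜ * pid n (S : Set ℕ)ᶜ := by
      apply ext'
      ext ⟨x, y⟩
      simp only [mul_graph, pid, Finset.coe_insert, Set.mem_ofPred_eq, Set.mem_compl_iff,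
        Set.mem_insert_iff, Set.mem_singleton_iff]
      constructor
      · rintro ⟨hx, hxS, rfl⟩
        exact ⟨y, ⟨hx, fun h => hxS (Or.inl h), rfl⟩, hx, fun h => hxS (Or.inr h), rfl⟩
      · rintro ⟨z, ⟨hx, hxa, rfl⟩, -, hxS, rfl⟩
        exact ⟨hx, fun h => h.elim hxa hxS, rfl⟩
    rw [hmul]
    exact Subsemigroup.mul_mem _ ha ih

theorem pid_mem_closure (n : ℕ) (D : Set ℕ) : pid n D ∈ Subsemigroup.closure (Jset n) := by
  classical
  have h : pid n D = pid n ((Finset.Icc 1 n).filter (· ∉ D) : Set ℕ)ᶜ := by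
    apply ext'
    ext ⟨x, y⟩
    simp only [pid, Set.mem_ofPred_eq, Set.mem_compl_iff, Finset.coe_filter, Finset.mem_Icc,
      Set.mem_Icc]
    tauto
  rw [h]
  exact pid_compl_mem_closure n _

/-- The partial injection `β_{i,j}` with graph `betaGraph n i j`; the walls `i = 0` and
`j = n + 1` are allowed. -/
def beta (n i j : ℕ) (hj : j ≤ n + 1) : PartialInj n where
  graph := betaGraph n i j
  mem_le := by
    rintro ⟨x, y⟩ ⟨h1, h2, h3, h4, h5⟩
    dsimp only at *
    split_ifs at h5 <;> omega
  functional := by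
    rintro p ⟨-, -, -, -, hp⟩ q ⟨-, -, -, -, hq⟩ h
    rw [hp, hq, h]
  injOn := by
    rintro ⟨x, y⟩ ⟨h1, h2, h3, h4, h5⟩ ⟨x', y'⟩ ⟨h1', h2', h3', h4', h5'⟩ h
    dsimp only at *
    split_ifs at h5 h5' <;> omega

theorem swap_mem_betaGraph {n i j x y : ℕ} (hj : j ≤ n + 1) (h : (x, y) ∈ betaGraph n i j) :
    (y, x) ∈ betaGraph n i j := by
  obtain ⟨h1, h2, h3, h4, h5⟩ := h
  simp only [betaGraph, Set.mem_ofPred_eq] at *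
  split_ifs at h5 ⊢ <;> omega

theorem beta_inv (n i j : ℕ) (hj : j ≤ n + 1) : (beta n i j hj).inv = beta n i j hj :=
  ext' (Set.ext fun _ => ⟨swap_mem_betaGraph hj, swap_mem_betaGraph hj⟩)

theorem beta_FP (n i j : ℕ) (hj : j ≤ n + 1) (hij : Even (i + j)) : (beta n i j hj).FP := by
  rintro ⟨x, y⟩ ⟨h1, h2, h3, h4, h5⟩ ⟨x', y'⟩ ⟨h1', h2', h3', h4', h5'⟩ ⟨h, he⟩
  simp only [fenceLt, Nat.even_iff] at *
  split_ifs at h5 h5' <;> omega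

theorem beta_mem_Jset (n i j : ℕ) (hj : j ≤ n + 1) (hij : Even (i + j)) :
    beta n i j hj ∈ Jset n := by
  have hFP := beta_FP n i j hj hij
  refine mem_Jset_of_diff_pair_subset_im ⟨hFP, by rwa [beta_inv]⟩ i j ?_
  rintro y ⟨⟨h1, h2⟩, hy⟩
  simp only [Set.mem_insert_iff, Set.mem_singleton_iff, not_or] at hy
  exact ⟨if i < y ∧ y < j then i + j - y else y, swap_mem_betaGraph hj ⟨h1, h2, hy.1, hy.2, rfl⟩⟩

theorem inv_mul (n : ℕ) (α β : PartialInj n) : (α * β).inv = β.inv * α.inv :=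
  ext' (Set.ext fun _ => ⟨fun ⟨y, h1, h2⟩ => ⟨y, h2, h1⟩, fun ⟨y, h1, h2⟩ => ⟨y, h2, h1⟩⟩)

theorem pid_inv (n : ℕ) (D : Set ℕ) : (pid n D).inv = pid n D := by
  apply ext'
  ext ⟨x, y⟩
  constructor <;> rintro ⟨h1, h2, h3⟩ <;> obtain rfl : x = y := by simp_all
  all_goals exact ⟨h1, h2, rfl⟩

/-- Lemma 4: with `p` even, the reversing shift `x ↦ 2m + p + 2k - x` of
`{m, …, m+p}` lies in `⟨J⟩`. -/
theorem lemma4 (n m p k : ℕ) (hm : 1 ≤ m) (hp : 1 ≤ p) (hk : 1 ≤ k) (hpeven : Even p)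
    (hmp : m + p + 2 * k ≤ n) (α : PartialInj n)
    (hgraph : α.graph = {q : ℕ × ℕ |
      q.1 ∈ Set.Icc 1 (m - 2) ∪ Set.Icc m (m + p) ∪ Set.Icc (m + p + 2 * k + 2) n ∧
      q.2 = if m ≤ q.1 ∧ q.1 ≤ m + p then 2 * m + p + 2 * k - q.1 else q.1}) :
    α ∈ Subsemigroup.closure (Jset n) ∧ α.inv ∈ Subsemigroup.closure (Jset n) := by
  have hj : m + p + 2 * k + 1 ≤ n + 1 := by omega
  have hβ := Subsemigroup.subset_closure (beta_mem_Jset n (m - 1) (m + p + 2 * k + 1) hj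
    (by rw [Nat.even_iff] at *; omega))
  set D : Set ℕ := Set.Icc 1 (m - 2) ∪ Set.Icc m (m + p) ∪ Set.Icc (m + p + 2 * k + 2) n
  have hα : α = pid n D * beta n (m - 1) (m + p + 2 * k + 1) hj := by
    apply ext'
    ext ⟨x, y⟩
    rw [hgraph]
    simp only [mul_graph, pid, beta, betaGraph, D, Set.mem_ofPred_eq, Set.mem_union, Set.mem_Icc]
    constructor
    · rintro ⟨hx, hy⟩
      refine ⟨x, ⟨by omega, hx, rfl⟩, by omega, by omega, by omega, by omega, ?_⟩
      split_ifs at hy ⊢ <;> omega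
    · rintro ⟨z, ⟨-, hx, rfl⟩, h1, h2, h3, h4, hy⟩
      refine ⟨hx, ?_⟩
      split_ifs at hy ⊢ <;> omega
  have hD := pid_mem_closure n D
  rw [hα, inv_mul, pid_inv, beta_inv]
  exact ⟨Subsemigroup.mul_mem _ hD hβ, Subsemigroup.mul_mem _ hβ hD⟩

end FencePaper
end

section
/- Let α ∈ IF_n. Then there exist natural numbers k < l and elements η₁, …, η_l ∈ J with η₁⁻¹, …, η_l⁻¹ ∈ J such that, setting ω = η₁ ⋯ η_k and ω′ = η_{k+1} ⋯ η_l, one has dom α ⊆ im ω, im α ⊆ dom ω′, and x(ωαω′) ≡ x (mod 2) for all x ∈ dom(ωαω′). -/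
/-!
Common framework: partial injections on `X_n = {1, …, n}`, the fence order,
fence-preserving partial injections, the semigroups `PFI_n`, `IF_n`,
the set `J` of elements of rank at least `n - 2`, and (for even `n`)
the generating system `G`.
-/

namespace FencePaper

open PartialInj

namespace PartialInj

variable {n : ℕ}

theorem mem_mul {α β : PartialInj n} {x z : ℕ} :
    (x, z) ∈ (α * β).graph ↔ ∃ y, (x, y) ∈ α.graph ∧ (y, z) ∈ β.graph := Iff.rfl

theorem mem_inv {α : PartialInj n} {x y : ℕ} : (x, y) ∈ α.inv.graph ↔ (y, x) ∈ α.graph := Iff.rfl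

theorem mem_one {x y : ℕ} : (x, y) ∈ (1 : PartialInj n).graph ↔ (1 ≤ x ∧ x ≤ n) ∧ y = x :=
  ⟨fun h => ⟨h.1, h.2.2⟩, fun h => ⟨h.1, h.1, h.2⟩⟩

theorem inv_one : (1 : PartialInj n).inv = 1 := by
  apply ext'
  ext ⟨x, y⟩
  rw [mem_inv, mem_one, mem_one]
  grind

theorem inv_prod (L : List (PartialInj n)) :
    L.prod.inv = (L.map inv).reverse.prod := by
  induction L with
  | nil => exact inv_one
  | cons a L ih => simp [inv_mul, ih]

/-- The map sending `y` to `1`, shifting the points below `y - 1` up by `2` and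
fixing the points above `y + 1`. -/
def moveToFront (n y : ℕ) (h1 : 1 ≤ y) (hn : y ≤ n) : PartialInj n where
  graph := {p | (1 ≤ p.1 ∧ p.1 ≤ n ∧ p.1 + 1 ≠ y ∧ p.1 ≠ y + 1) ∧
    p.2 = if p.1 < y then p.1 + 2 else if p.1 = y then 1 else p.1}
  mem_le := by
    rintro ⟨a, b⟩ ⟨h, h'⟩
    dsimp only at *
    split_ifs at h' <;> omega
  functional := by
    rintro ⟨a, b⟩ ⟨h, h'⟩ ⟨c, d⟩ ⟨k, k'⟩ e
    dsimp only at *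
    subst e
    rw [h', k']
  injOn := by
    rintro ⟨a, b⟩ ⟨h, h'⟩ ⟨c, d⟩ ⟨k, k'⟩ e
    dsimp only at *
    split_ifs at h' k' <;> omega

theorem mem_moveToFront {y : ℕ} {h1 : 1 ≤ y} {hn : y ≤ n} {a b : ℕ} :
    (a, b) ∈ (moveToFront n y h1 hn).graph ↔
      (1 ≤ a ∧ a ≤ n ∧ a + 1 ≠ y ∧ a ≠ y + 1) ∧
        b = if a < y then a + 2 else if a = y then 1 else a := Iff.rfl

end PartialInj

theorem one_mem_IFset (n : ℕ) : (1 : PartialInj n) ∈ IFset n := by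
  have h : (1 : PartialInj n).FP := by
    rintro ⟨a, b⟩ h ⟨c, d⟩ k e
    rw [mem_one] at h k
    rwa [h.2, k.2]
  exact ⟨h, by rwa [inv_one]⟩

theorem prod_mem_IFset {n : ℕ} (L : List (PartialInj n)) (hL : ∀ g ∈ L, g ∈ IFset n) :
    L.prod ∈ IFset n := by
  induction L with
  | nil => exact one_mem_IFset n
  | cons a L ih =>
    rw [List.prod_cons]
    exact mul_mem_IFset (hL a (by simp)) (ih fun g hg => hL g (by simp [hg]))

theorem mem_Jset_of_subset {n : ℕ} {α : PartialInj n} (hα : α ∈ IFset n) (a b : ℕ)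
    (h : ∀ z, 1 ≤ z → z ≤ n → z ≠ a → z ≠ b → z ∈ α.im) : α ∈ Jset n := by
  refine ⟨hα, ?_⟩
  have hfin : α.im.Finite := (Set.finite_Icc 1 n).subset fun z ⟨x, hx⟩ =>
    ⟨(α.mem_le _ hx).2.2.1, (α.mem_le _ hx).2.2.2⟩
  have hsub : Set.Icc 1 n ⊆ α.im ∪ {a, b} := by
    intro z hz
    by_cases ha : z = a
    · simp [ha]
    by_cases hb : z = b
    · simp [hb]
    exact Or.inl (h z hz.1 hz.2 ha hb)
  have h1 := Set.ncard_le_ncard hsub (hfin.union (by simp))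
  have h2 := Set.ncard_union_le α.im {a, b}
  have h3 : ({a, b} : Set ℕ).ncard ≤ 2 := (Set.ncard_insert_le a {b}).trans (by simp)
  have h4 : (Set.Icc 1 n).ncard = n := by simp [Set.ncard_eq_toFinset_card']
  unfold rank
  omega

theorem one_mem_Jset (n : ℕ) : (1 : PartialInj n) ∈ Jset n :=
  mem_Jset_of_subset (one_mem_IFset n) 0 0 fun z h1 h2 _ _ => ⟨z, mem_one.2 ⟨⟨h1, h2⟩, rfl⟩⟩

theorem moveToFront_mem_IFset {n y : ℕ} (hy : Even y) (h1 : 1 ≤ y) (hn : y ≤ n) :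
    moveToFront n y h1 hn ∈ IFset n := by
  have hy' := Nat.even_iff.1 hy
  constructor
  · rintro ⟨a, b⟩ h ⟨c, d⟩ k e
    rw [mem_moveToFront] at h k
    obtain ⟨h, h'⟩ := h
    obtain ⟨k, k'⟩ := k
    simp only [fenceLt, Nat.even_iff] at *
    split_ifs at h' k' <;> omega
  · rintro ⟨a, b⟩ h ⟨c, d⟩ k e
    rw [mem_inv, mem_moveToFront] at h k
    obtain ⟨h, h'⟩ := h
    obtain ⟨k, k'⟩ := k
    simp only [fenceLt, Nat.even_iff] at *
    split_ifs at h' k' <;> omega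

theorem moveToFront_mem_Jset {n y : ℕ} (hy : Even y) (h1 : 1 ≤ y) (hn : y ≤ n) :
    moveToFront n y h1 hn ∈ Jset n := by
  have hy' := Nat.even_iff.1 hy
  refine mem_Jset_of_subset (moveToFront_mem_IFset hy h1 hn) 2 (y + 1) fun z hz hzn h2 h3 => ?_
  refine ⟨if z = 1 then y else if z ≤ y then z - 2 else z, mem_moveToFront.2 ?_⟩
  split_ifs <;> omega

theorem inv_moveToFront_mem_Jset {n y : ℕ} (hy : Even y) (h1 : 1 ≤ y) (hn : y ≤ n) :
    (moveToFront n y h1 hn).inv ∈ Jset n := by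
  refine mem_Jset_of_subset (inv_mem_IFset (moveToFront_mem_IFset hy h1 hn)) (y - 1) (y + 1)
    fun z hz hzn h2 h3 => ⟨_, mem_inv.2 (mem_moveToFront.2 ⟨?_, rfl⟩)⟩
  omega

/-- Every partial injection can be multiplied on the right by elements of `J` so that the isolated
points of the image become odd. -/
theorem exists_isolated_odd {n : ℕ} (α : PartialInj n) :
    ∃ L : List (PartialInj n), (∀ g ∈ L, g ∈ Jset n ∧ g.inv ∈ Jset n) ∧ α.im ⊆ L.prod.dom ∧
      ∀ z ∈ (α * L.prod).im, Odd z ∨ ∃ w ∈ (α * L.prod).im, w + 1 = z ∨ z + 1 = w := by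
  induction hm : {x | ∃ z, Even z ∧ (x, z) ∈ α.graph}.ncard using Nat.strong_induction_on
    generalizing α with
  | _ m ih =>
  by_cases hE : ∀ z ∈ α.im, Odd z ∨ ∃ w ∈ α.im, w + 1 = z ∨ z + 1 = w
  · refine ⟨[], by simp, ?_, by simpa using hE⟩
    rintro y ⟨x, hx⟩
    obtain ⟨-, -, h⟩ := α.mem_le _ hx
    exact ⟨y, mem_one.2 ⟨h, rfl⟩⟩
  push Not at hE
  obtain ⟨y, ⟨x, hx⟩, hy, hiso⟩ := hE
  have hy : Even y := by simpa using hy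
  obtain ⟨-, -, h1, hn⟩ := α.mem_le _ hx
  dsimp only at h1 hn
  set τ := moveToFront n y h1 hn
  have hdom : α.im ⊆ τ.dom := by
    rintro z ⟨t, ht⟩
    obtain ⟨-, -, hz, hz'⟩ := α.mem_le _ ht
    have := hiso z ⟨t, ht⟩
    exact ⟨_, mem_moveToFront.2 ⟨⟨hz, hz', by omega, by omega⟩, rfl⟩⟩
  have hlt : {x | ∃ z, Even z ∧ (x, z) ∈ (α * τ).graph}.ncard < m := by
    rw [← hm]
    apply Set.ncard_lt_ncard
    · rw [Set.ssubset_iff_of_subset]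
      · refine ⟨x, ⟨y, hy, hx⟩, ?_⟩
        rintro ⟨z, hz, hxz⟩
        obtain ⟨w, hw, hwz⟩ := mem_mul.1 hxz
        have : w = y := α.functional _ hw _ hx rfl
        subst this
        obtain ⟨-, e⟩ := mem_moveToFront.1 hwz
        simp only [lt_irrefl, if_true, if_false] at e
        subst e
        simp at hz
      · rintro t ⟨z, hz, htz⟩
        obtain ⟨w, hw, hwz⟩ := mem_mul.1 htz
        refine ⟨w, ?_, hw⟩
        obtain ⟨-, e⟩ := mem_moveToFront.1 hwz
        rw [Nat.even_iff] at *
        split_ifs at e <;> omega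
    · exact (Set.finite_Icc 1 n).subset fun t ⟨z, _, hz⟩ =>
        ⟨(α.mem_le _ hz).1, (α.mem_le _ hz).2.1⟩
  obtain ⟨L, hL, hLdom, hLodd⟩ := ih _ hlt (α * τ) rfl
  refine ⟨τ :: L, ?_, ?_, ?_⟩
  · intro g hg
    rcases List.mem_cons.1 hg with rfl | hg
    · exact ⟨moveToFront_mem_Jset hy h1 hn, inv_moveToFront_mem_Jset hy h1 hn⟩
    · exact hL g hg
  · rintro z ⟨t, ht⟩
    obtain ⟨w, hw⟩ := hdom ⟨t, ht⟩
    obtain ⟨v, hv⟩ := hLdom ⟨t, mem_mul.2 ⟨z, ht, hw⟩⟩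
    exact ⟨v, by rw [List.prod_cons]; exact mem_mul.2 ⟨w, hw, hv⟩⟩
  · rw [List.prod_cons, ← mul_assoc]
    exact hLodd

theorem parity_eq_of_adjacent {n : ℕ} {α : PartialInj n} (hα : α ∈ IFset n) {x z x' z' : ℕ}
    (h : (x, z) ∈ α.graph) (h' : (x', z') ∈ α.graph) (hadj : x' + 1 = x ∨ x + 1 = x') :
    z % 2 = x % 2 := by
  have e1 := hα.1 _ h _ h'
  have e2 := hα.1 _ h' _ h
  simp only [fenceLt, Nat.even_iff] at e1 e2
  omega

/-- Proposition 1: `α` can be multiplied by elements of `J` (with inverses in `J`)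
so that the result preserves parity. -/
theorem prop1 (n : ℕ) (α : PartialInj n) (hα : α ∈ IFset n) :
    ∃ k l : ℕ, 1 ≤ k ∧ k < l ∧ ∃ η : ℕ → PartialInj n,
      (∀ i, 1 ≤ i → i ≤ l → η i ∈ Jset n ∧ (η i).inv ∈ Jset n) ∧
      α.dom ⊆ (((List.range' 1 k).map η).prod).im ∧
      α.im ⊆ (((List.range' (k + 1) (l - k)).map η).prod).dom ∧
      ∀ q ∈ (((List.range' 1 k).map η).prod * α *
          ((List.range' (k + 1) (l - k)).map η).prod).graph,
        q.2 % 2 = q.1 % 2 := by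
  obtain ⟨R, hR, hRdom, hRodd⟩ := exists_isolated_odd α
  obtain ⟨L, hL, hLdom, hLodd⟩ := exists_isolated_odd α.inv
  have hinv_inv : ∀ g : PartialInj n, g.inv.inv = g := fun _ => rfl
  have hone := one_mem_Jset n
  have hone' : (1 : PartialInj n).inv ∈ Jset n := by rwa [inv_one]
  set A := 1 :: (L.map PartialInj.inv).reverse with hA
  set B := 1 :: R with hB
  have hAJ : ∀ g ∈ A, g ∈ Jset n ∧ g.inv ∈ Jset n := by
    intro g hg
    simp only [hA, List.mem_cons, List.mem_reverse, List.mem_map] at hg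
    rcases hg with rfl | ⟨f, hf, rfl⟩
    · exact ⟨hone, hone'⟩
    · exact ⟨(hL f hf).2, (hL f hf).1⟩
  have hBJ : ∀ g ∈ B, g ∈ Jset n ∧ g.inv ∈ Jset n := by
    intro g hg
    rcases List.mem_cons.1 hg with rfl | hg
    · exact ⟨hone, hone'⟩
    · exact hR g hg
  have hAprod : A.prod = L.prod.inv := by rw [hA, List.prod_cons, one_mul, inv_prod]
  have hBprod : B.prod = R.prod := by rw [hB, List.prod_cons, one_mul]
  have hIF : L.prod.inv * α * R.prod ∈ IFset n :=
    mul_mem_IFset (mul_mem_IFset (inv_mem_IFset (prod_mem_IFset L fun g hg => (hL g hg).1.1)) hα)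
      (prod_mem_IFset R fun g hg => (hR g hg).1.1)
  refine ⟨A.length, A.length + B.length, by simp [hA], by simp [hB],
    fun i => (A ++ B).getD (i - 1) 1, ?_, ?_⟩
  · intro i h1 h2
    have hi : i - 1 < (A ++ B).length := by rw [List.length_append]; omega
    dsimp only
    rw [List.getD_eq_getElem _ _ hi]
    rcases List.mem_append.1 (List.getElem_mem hi) with h | h
    · exact hAJ _ h
    · exact hBJ _ h
  have eA : (List.range' 1 A.length).map (fun i => (A ++ B).getD (i - 1) 1) = A := by
    apply List.ext_getElem
    · simp
    · intro i h1 h2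
      simp [List.getElem?_append_left h2, List.getElem?_eq_getElem h2]
  have eB : (List.range' (A.length + 1) (A.length + B.length - A.length)).map
      (fun i => (A ++ B).getD (i - 1) 1) = B := by
    apply List.ext_getElem
    · simp
    · intro i h1 h2
      have : A.length + 1 + i - 1 = A.length + i := by omega
      simp [this, List.getElem?_append_right, List.getElem?_eq_getElem h2]
  rw [eA, eB, hAprod, hBprod]
  refine ⟨hLdom, hRdom, ?_⟩
  rintro ⟨x, z⟩ hq
  obtain ⟨b, ⟨a, hxa, hab⟩, hbz⟩ := hq
  dsimp only at hxa hab hbz ⊢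
  rcases hLodd x ⟨b, a, hab, hxa⟩ with hx | ⟨x', ⟨b', a', hab', hxa'⟩, hadj⟩
  · rcases hRodd z ⟨a, b, hab, hbz⟩ with hz | ⟨z', ⟨a', b', hab', hbz'⟩, hadj⟩
    · rw [Nat.odd_iff.1 hx, Nat.odd_iff.1 hz]
    · obtain ⟨x', hx'⟩ := hLdom ⟨b', hab'⟩
      exact (parity_eq_of_adjacent (inv_mem_IFset hIF) (x := z) (z := x) (x' := z') (z' := x')
        ⟨b, ⟨a, hxa, hab⟩, hbz⟩ ⟨b', ⟨a', hx', hab'⟩, hbz'⟩ hadj).symm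
  · obtain ⟨z', hz'⟩ := hRdom ⟨a', hab'⟩
    exact parity_eq_of_adjacent hIF (x := x) (z := z) (x' := x') (z' := z')
      ⟨b, ⟨a, hxa, hab⟩, hbz⟩ ⟨b', ⟨a', hxa', hab'⟩, hz'⟩ hadj

end FencePaper
end
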